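/- arXiv:1911.02758 — 2 statements merged into one kernel-verified Lean document; each statement's English description precedes it below -/
import Mathlib

section
/- Let Q be a quasiorder, X and Y second-countable T₀ topological spaces with Borel bases 𝓛(X) and 𝓛(Y), f : X → Y a continuous function, and u a term. If A ∈ 𝓛(Y,u) then A∘f ∈ 𝓛(X,u). -/
open Set

namespace IFHpaper

noncomputable section

/-- The first uncountable ordinal. -/
def w1 : Ordinal.{0} := (Cardinal.aleph 1).ord

/-- A tree: a nonempty, prefix-closed set of finite sequences of naturals. -/
def IsTree (T : Set (List ℕ)) : Prop :=
  T.Nonempty ∧ ∀ σ τ : List ℕ, σ <+: τ → τ ∈ T → σ ∈ T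

/-- A well-founded tree: a tree with no infinite path. -/
def IsWFTree (T : Set (List ℕ)) : Prop :=
  IsTree T ∧ ∀ x : ℕ → ℕ, ∃ n : ℕ, (List.range n).map x ∉ T

/-- The proper extensions of `τ` lying in `T`. -/
def properExt (T : Set (List ℕ)) (τ : List ℕ) : Set (List ℕ) :=
  {τ' | τ' ∈ T ∧ τ <+: τ' ∧ τ ≠ τ'}

/-- The component of a `T`-family at node `τ`:  `U τ` minus the union of the sets
attached to proper extensions of `τ` in `T`. -/
def component {X : Type} (T : Set (List ℕ)) (U : List ℕ → Set X) (τ : List ℕ) : Set X :=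
  U τ \ ⋃ τ' ∈ properExt T τ, U τ'

/-- A `T`-family is monotone if `U τ ⊇ U τ'` whenever `τ ⊑ τ'` in `T`. -/
def MonotoneFam {X : Type} (T : Set (List ℕ)) (U : List ℕ → Set X) : Prop :=
  ∀ τ ∈ T, ∀ τ' ∈ T, τ <+: τ' → U τ' ⊆ U τ

/-- A reduced `T`-family: monotone, with disjoint sets at distinct one-step extensions. -/
def ReducedFam {X : Type} (T : Set (List ℕ)) (U : List ℕ → Set X) : Prop :=
  MonotoneFam T U ∧
    ∀ (τ : List ℕ) (i j : ℕ), τ ++ [i] ∈ T → τ ++ [j] ∈ T → i ≠ j →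
      U (τ ++ [i]) ∩ U (τ ++ [j]) = ∅

/-- An infinite-branching tree: every non-leaf node has all its one-step extensions in `T`. -/
def InfBranching (T : Set (List ℕ)) : Prop :=
  ∀ τ ∈ T, (∃ τ' ∈ T, τ <+: τ' ∧ τ ≠ τ') → ∀ i : ℕ, τ ++ [i] ∈ T

/-- The σ-reduction property for a collection of sets. -/
def SigmaReduction {X : Type} (𝒜 : Set (Set X)) : Prop :=
  ∀ C : ℕ → Set X, (∀ i, C i ∈ 𝒜) →
    ∃ C' : ℕ → Set X, (∀ i, C' i ∈ 𝒜) ∧ (∀ i, C' i ⊆ C i) ∧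
      (∀ i j, i ≠ j → C' i ∩ C' j = ∅) ∧ (⋃ i, C' i) = ⋃ i, C i

/-- A (hierarchy) base in a set `X`: an `ω₁`-indexed family of collections of subsets of `X`,
each closed under countable unions and finite intersections, and increasing in the
appropriate sense. -/
structure IsBase {X : Type} (L : Ordinal.{0} → Set (Set X)) : Prop where
  iUnion_mem : ∀ α < w1, ∀ f : ℕ → Set X, (∀ n, f n ∈ L α) → (⋃ n, f n) ∈ L α
  inter_mem : ∀ α < w1, ∀ A B : Set X, A ∈ L α → B ∈ L α → A ∩ B ∈ L α
  empty_mem : ∀ α < w1, (∅ : Set X) ∈ L α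
  univ_mem : ∀ α < w1, (univ : Set X) ∈ L α
  mono : ∀ α β : Ordinal.{0}, α < β → β < w1 → ∀ A : Set X, A ∈ L α → A ∈ L β ∧ Aᶜ ∈ L β

/-- The `β`-shift of a base: level `α` of the shift is level `β + α` of `L`. -/
def shiftL {X : Type} (L : Ordinal.{0} → Set (Set X)) (β : Ordinal.{0}) :
    Ordinal.{0} → Set (Set X) := fun α => L (β + α)

/-- The `V`-restriction of a base: level `α` consists of the sets `V ∩ S`, `S ∈ L α`. -/
def restrictL {X : Type} (L : Ordinal.{0} → Set (Set X)) (V : Set X) :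
    Ordinal.{0} → Set (Set X) := fun α => {W | ∃ S ∈ L α, W = V ∩ S}

open Classical in
/-- The Borel hierarchy `Σ⁰_α(X)` (defined for `1 ≤ α`): `Σ⁰₁` is the open sets, `Σ⁰₂` the
countable unions of differences of open sets, and for `α > 2`, `Σ⁰_α` consists of the
countable unions of complements of sets in lower levels `Σ⁰_β`, `1 ≤ β < α`. -/
def SigmaO (X : Type) [TopologicalSpace X] (α : Ordinal.{0}) : Set (Set X) :=
  if α = 1 then {U : Set X | IsOpen U}
  else if α = 2 then
    {A : Set X | ∃ U V : ℕ → Set X, (∀ n, IsOpen (U n)) ∧ (∀ n, IsOpen (V n)) ∧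
      A = ⋃ n, U n \ V n}
  else
    {A : Set X | ∃ S : ℕ → Set X,
      (∀ n, ∃ β : Ordinal.{0}, ∃ _ : β < α, 1 ≤ β ∧ S n ∈ SigmaO X β) ∧ A = ⋃ n, (S n)ᶜ}
termination_by α
decreasing_by assumption

/-- The Borel base of a topological space: level `α` is `Σ⁰_{1+α}(X)`. -/
def borelBase (X : Type) [TopologicalSpace X] : Ordinal.{0} → Set (Set X) :=
  fun α => SigmaO X (1 + α)

/-- The existential category quantifier `f[A]`:  the set of `y` such that `A ∩ f⁻¹(y)` is
non-meager in the subspace `f⁻¹(y)`. -/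
def catIm {X Y : Type} [TopologicalSpace X] (f : X → Y) (A : Set X) : Set Y :=
  {y | ¬ IsMeagre ((Subtype.val : (f ⁻¹' {y} : Set X) → X) ⁻¹' A)}

/-- A space is zero-dimensional if it has a basis of clopen sets. -/
def ZeroDim (X : Type) [TopologicalSpace X] : Prop :=
  ∀ (x : X) (U : Set X), IsOpen U → x ∈ U → ∃ V : Set X, IsClopen V ∧ x ∈ V ∧ V ⊆ U

/-- Countable ordinals. -/
abbrev CtbOrd : Type 1 := {α : Ordinal.{0} // α < w1}

/-- Terms over a quasiorder `Q`: constants `q ∈ Q`, unary `s_α`, and `ω`-ary `F_q`, `F_α`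
(`α` a countable ordinal). -/
inductive Term (Q : Type) : Type 1 where
  | const : Q → Term Q
  | s : CtbOrd → Term Q → Term Q
  | Fc : Q → (ℕ → Term Q) → Term Q
  | Fo : CtbOrd → (ℕ → Term Q) → Term Q

/-- The relation `⊴` on terms. -/
inductive TLE {Q : Type} [Preorder Q] : Term Q → Term Q → Prop where
  | const_const {q r : Q} : q ≤ r → TLE (.const q) (.const r)
  | const_s {q : Q} {a : CtbOrd} {u : Term Q} :
      TLE (.const q) u → TLE (.const q) (.s a u)
  | const_Fc_left {q r : Q} {vs : ℕ → Term Q} :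
      TLE (.const q) (.const r) → TLE (.const q) (.Fc r vs)
  | const_Fc_right {q r : Q} {vs : ℕ → Term Q} (i : ℕ) :
      TLE (.const q) (vs i) → TLE (.const q) (.Fc r vs)
  | const_Fo {q : Q} {b : CtbOrd} {vs : ℕ → Term Q} (i : ℕ) :
      TLE (.const q) (vs i) → TLE (.const q) (.Fo b vs)
  | s_const {a : CtbOrd} {u : Term Q} {r : Q} :
      TLE u (.const r) → TLE (.s a u) (.const r)
  | s_s_lt {a b : CtbOrd} {u v : Term Q} :
      a.1 < b.1 → TLE u (.s b v) → TLE (.s a u) (.s b v)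
  | s_s_eq {a : CtbOrd} {u v : Term Q} :
      TLE u v → TLE (.s a u) (.s a v)
  | s_s_gt {a b : CtbOrd} {u v : Term Q} :
      b.1 < a.1 → TLE (.s a u) v → TLE (.s a u) (.s b v)
  | s_Fc_left {a : CtbOrd} {u : Term Q} {r : Q} {vs : ℕ → Term Q} :
      TLE (.s a u) (.const r) → TLE (.s a u) (.Fc r vs)
  | s_Fc_right {a : CtbOrd} {u : Term Q} {r : Q} {vs : ℕ → Term Q} (i : ℕ) :
      TLE (.s a u) (vs i) → TLE (.s a u) (.Fc r vs)
  | s_Fo_left {a : CtbOrd} {u : Term Q} {b : CtbOrd} {vs : ℕ → Term Q} :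
      TLE (.s a u) (.s b (vs 0)) → TLE (.s a u) (.Fo b vs)
  | s_Fo_right {a : CtbOrd} {u : Term Q} {b : CtbOrd} {vs : ℕ → Term Q} (i : ℕ) :
      TLE (.s a u) (vs (i + 1)) → TLE (.s a u) (.Fo b vs)
  | Fc_const {q : Q} {us : ℕ → Term Q} {r : Q} :
      TLE (.const q) (.const r) → (∀ i, TLE (us i) (.const r)) →
      TLE (.Fc q us) (.const r)
  | Fc_s {q : Q} {us : ℕ → Term Q} {b : CtbOrd} {v : Term Q} :
      TLE (.const q) (.s b v) → (∀ i, TLE (us i) (.s b v)) →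
      TLE (.Fc q us) (.s b v)
  | Fc_Fc_left {q : Q} {us : ℕ → Term Q} {r : Q} {vs : ℕ → Term Q} :
      TLE (.const q) (.const r) → (∀ i, TLE (us i) (.Fc r vs)) →
      TLE (.Fc q us) (.Fc r vs)
  | Fc_Fc_right {q : Q} {us : ℕ → Term Q} {r : Q} {vs : ℕ → Term Q} (i : ℕ) :
      TLE (.Fc q us) (vs i) → TLE (.Fc q us) (.Fc r vs)
  | Fc_Fo_left {q : Q} {us : ℕ → Term Q} {b : CtbOrd} {vs : ℕ → Term Q} :
      TLE (.const q) (.s b (vs 0)) → (∀ i, TLE (us i) (.Fo b vs)) →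
      TLE (.Fc q us) (.Fo b vs)
  | Fc_Fo_right {q : Q} {us : ℕ → Term Q} {b : CtbOrd} {vs : ℕ → Term Q} (i : ℕ) :
      TLE (.Fc q us) (vs (i + 1)) → TLE (.Fc q us) (.Fo b vs)
  | Fo_const {a : CtbOrd} {us : ℕ → Term Q} {r : Q} :
      TLE (.s a (us 0)) (.const r) → (∀ i, TLE (us (i + 1)) (.const r)) →
      TLE (.Fo a us) (.const r)
  | Fo_s {a : CtbOrd} {us : ℕ → Term Q} {b : CtbOrd} {v : Term Q} :
      TLE (.s a (us 0)) (.s b v) → (∀ i, TLE (us (i + 1)) (.s b v)) →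
      TLE (.Fo a us) (.s b v)
  | Fo_Fc_left {a : CtbOrd} {us : ℕ → Term Q} {r : Q} {vs : ℕ → Term Q} :
      TLE (.s a (us 0)) (.const r) → (∀ i, TLE (us (i + 1)) (.Fc r vs)) →
      TLE (.Fo a us) (.Fc r vs)
  | Fo_Fc_right {a : CtbOrd} {us : ℕ → Term Q} {r : Q} {vs : ℕ → Term Q} (i : ℕ) :
      TLE (.Fo a us) (vs i) → TLE (.Fo a us) (.Fc r vs)
  | Fo_Fo_left {a : CtbOrd} {us : ℕ → Term Q} {b : CtbOrd} {vs : ℕ → Term Q} :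
      TLE (.s a (us 0)) (.s b (vs 0)) → (∀ i, TLE (us (i + 1)) (.Fo b vs)) →
      TLE (.Fo a us) (.Fo b vs)
  | Fo_Fo_right {a : CtbOrd} {us : ℕ → Term Q} {b : CtbOrd} {vs : ℕ → Term Q} (i : ℕ) :
      TLE (.Fo a us) (vs (i + 1)) → TLE (.Fo a us) (.Fo b vs)

/-- `u`-families over a base `L`, on a domain (ambient set) `D ⊆ X`, defined by recursion
on the term `u` following the labeled tree `T(u)`:
* a `q`-family is trivial;
* an `s_α(u)`-family is a `u`-family over the `ω^α`-shift of the base;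
* an `F_q(u₀,…)`-family consists of a monotone `T(u)`-family of level-`0` sets of the base
  restricted to the current domain (encoded via the child sets `U i ∈ 𝓛₀(D)` together with,
  recursively, the `uᵢ`-families on the `U i`, which carry the deeper tree sets);
* an `F_α(u₀,…)`-family additionally carries the `s_α(u₀)`-family attached to the root,
  living on the component `D \ ⋃ᵢ U i` of the root. -/
inductive Fam {X Q : Type} : Term Q → (Ordinal.{0} → Set (Set X)) → Set X → Type 1 where
  | const (q : Q) (L : Ordinal.{0} → Set (Set X)) (D : Set X) : Fam (.const q) L D
  | s (a : CtbOrd) (u : Term Q) (L : Ordinal.{0} → Set (Set X)) (D : Set X) :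
      Fam u (shiftL L (Ordinal.omega0 ^ a.1)) D → Fam (.s a u) L D
  | Fc (q : Q) (us : ℕ → Term Q) (L : Ordinal.{0} → Set (Set X)) (D : Set X)
      (U : ℕ → Set X) (hU : ∀ i, U i ∈ restrictL L D 0)
      (fams : ∀ i, Fam (us i) L (U i)) : Fam (.Fc q us) L D
  | Fo (a : CtbOrd) (us : ℕ → Term Q) (L : Ordinal.{0} → Set (Set X)) (D : Set X)
      (U : ℕ → Set X) (hU : ∀ i, U i ∈ restrictL L D 0)
      (F0 : Fam (us 0) (shiftL L (Ordinal.omega0 ^ a.1)) (D \ ⋃ i, U i))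
      (fams : ∀ i, Fam (us (i + 1)) L (U i)) : Fam (.Fo a us) L D

/-- The relation "the `u`-family `F` (on domain `D`) determines the `Q`-partition `A`". -/
def Determines {X Q : Type} : (u : Term Q) → (L : Ordinal.{0} → Set (Set X)) → (D : Set X) →
    Fam u L D → (X → Q) → Prop
  | _, _, _, .const q _ D, A => ∀ x ∈ D, A x = q
  | _, _, _, .s a u L D F, A => Determines u (shiftL L (Ordinal.omega0 ^ a.1)) D F A
  | _, _, _, .Fc q us L D U _ fams, A =>
      (∀ x ∈ D \ ⋃ i, U i, A x = q) ∧ ∀ i, Determines (us i) L (U i) (fams i) A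
  | _, _, _, .Fo a us L D U _ F0 fams, A =>
      Determines (us 0) (shiftL L (Ordinal.omega0 ^ a.1)) (D \ ⋃ i, U i) F0 A ∧
        ∀ i, Determines (us (i + 1)) L (U i) (fams i) A

/-- A `u`-family is reduced if all monotone tree families occurring in it are reduced
(sets at distinct siblings are disjoint), recursively. -/
def FamReduced {X Q : Type} : (u : Term Q) → (L : Ordinal.{0} → Set (Set X)) → (D : Set X) →
    Fam u L D → Prop
  | _, _, _, .const _ _ _ => True
  | _, _, _, .s a u L D F => FamReduced u (shiftL L (Ordinal.omega0 ^ a.1)) D F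
  | _, _, _, .Fc _ us L _ U _ fams =>
      (∀ i j, i ≠ j → U i ∩ U j = ∅) ∧ ∀ i, FamReduced (us i) L (U i) (fams i)
  | _, _, _, .Fo a us L D U _ F0 fams =>
      (∀ i j, i ≠ j → U i ∩ U j = ∅) ∧
        FamReduced (us 0) (shiftL L (Ordinal.omega0 ^ a.1)) (D \ ⋃ i, U i) F0 ∧
        ∀ i, FamReduced (us (i + 1)) L (U i) (fams i)

/-- The level `𝓛(D,u)` of the infinitary fine hierarchy over the base `L` restricted to the
domain `D`: the `Q`-partitions determined by some `u`-family on `D`. -/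
def levelOn {X : Type} (Q : Type) (L : Ordinal.{0} → Set (Set X)) (D : Set X) (u : Term Q) :
    Set (X → Q) :=
  {A | ∃ F : Fam u L D, Determines u L D F A}

/-- The level `𝓛(X,u)` of the infinitary fine hierarchy over the base `L`. -/
def level {X : Type} (Q : Type) (L : Ordinal.{0} → Set (Set X)) (u : Term Q) : Set (X → Q) :=
  levelOn Q L Set.univ u

/-- `red-𝓛(X,u)`: the `Q`-partitions determined by some reduced `u`-family. -/
def levelRed {X : Type} (Q : Type) (L : Ordinal.{0} → Set (Set X)) (u : Term Q) :
    Set (X → Q) :=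
  {A | ∃ F : Fam u L Set.univ, FamReduced u L Set.univ F ∧ Determines u L Set.univ F A}

/-- Wadge reducibility of `Q`-partitions of a space `X`. -/
def WadgeLe {X : Type} [TopologicalSpace X] {Q : Type} [Preorder Q] (A B : X → Q) : Prop :=
  ∃ f : X → X, Continuous f ∧ ∀ x, A x ≤ B (f x)

/-- The downward Wadge closure `𝓛̂(X,u)` of the level `𝓛(X,u)`. -/
def levelHat {X : Type} [TopologicalSpace X] (Q : Type) [Preorder Q]
    (L : Ordinal.{0} → Set (Set X)) (u : Term Q) : Set (X → Q) :=
  {A | ∃ B ∈ level Q L u, WadgeLe A B}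


/-- Each class of the Borel hierarchy is closed under continuous preimages. -/
theorem preimage_mem_SigmaO {X Y : Type} [TopologicalSpace X] [TopologicalSpace Y]
    {f : X → Y} (hf : Continuous f) (α : Ordinal.{0}) :
    ∀ S ∈ SigmaO Y α, f ⁻¹' S ∈ SigmaO X α := by
  induction α using WellFoundedLT.induction with
  | ind α ih =>
    intro S hS
    rw [SigmaO] at hS ⊢
    split_ifs at hS ⊢
    · exact hS.preimage hf
    · obtain ⟨U, V, hU, hV, rfl⟩ := hS
      exact ⟨fun n => f ⁻¹' U n, fun n => f ⁻¹' V n, fun n => (hU n).preimage hf,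
        fun n => (hV n).preimage hf, by simp only [preimage_iUnion, preimage_sdiff]⟩
    · obtain ⟨T, hT, rfl⟩ := hS
      refine ⟨fun n => f ⁻¹' T n, fun n => ?_, by simp only [preimage_iUnion, preimage_compl]⟩
      obtain ⟨β, hβ, h1, hTn⟩ := hT n
      exact ⟨β, hβ, h1, ih β hβ _ hTn⟩

theorem preimage_mem_restrictL {X Y : Type} {f : X → Y} {L : Ordinal.{0} → Set (Set Y)}
    {M : Ordinal.{0} → Set (Set X)} {α : Ordinal.{0}} (h : ∀ S ∈ L α, f ⁻¹' S ∈ M α)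
    {D W : Set Y} (hW : W ∈ restrictL L D α) : f ⁻¹' W ∈ restrictL M (f ⁻¹' D) α := by
  obtain ⟨S, hS, rfl⟩ := hW
  exact ⟨f ⁻¹' S, h S hS, preimage_inter⟩

/-- If preimages under `f` map the levels of `L` into those of `M`, then the levels of the fine
hierarchy over `L` are pulled back along `f` to those over `M`. -/
theorem comp_mem_levelOn {X Y Q : Type} {f : X → Y} {u : Term Q} {A : Y → Q}
    {L : Ordinal.{0} → Set (Set Y)} {M : Ordinal.{0} → Set (Set X)} {D : Set Y}
    (h : ∀ α, ∀ S ∈ L α, f ⁻¹' S ∈ M α) (hA : A ∈ levelOn Q L D u) :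
    A ∘ f ∈ levelOn Q M (f ⁻¹' D) u := by
  obtain ⟨F, hF⟩ := hA
  induction F generalizing M with
  | const q L D => exact ⟨.const q M _, fun x hx => hF _ hx⟩
  | s a u L D F ih =>
    obtain ⟨G, hG⟩ := ih (M := shiftL M (Ordinal.omega0 ^ a.1)) (fun α => h _) hF
    exact ⟨.s a u M _ G, hG⟩
  | Fc q us L D U hU fams ih =>
    choose G hG using fun i => ih i h (hF.2 i)
    refine ⟨.Fc q us M _ (fun i => f ⁻¹' U i) (fun i => preimage_mem_restrictL (h 0) (hU i)) G,
      fun x hx => ?_, hG⟩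
    rw [← preimage_iUnion, ← preimage_sdiff] at hx
    exact hF.1 _ hx
  | Fo a us L D U hU F0 fams ih0 ih =>
    choose G hG using fun i => ih i h (hF.2 i)
    have h0 : A ∘ f ∈ levelOn Q (shiftL M (Ordinal.omega0 ^ a.1)) _ (us 0) :=
      ih0 (fun α => h _) hF.1
    rw [preimage_sdiff, preimage_iUnion] at h0
    obtain ⟨G0, hG0⟩ := h0
    exact ⟨.Fo a us M _ (fun i => f ⁻¹' U i) (fun i => preimage_mem_restrictL (h 0) (hU i)) G0 G,
      hG0, hG⟩

/-- Proposition "preim2": levels of the `Q`-IFH over the Borel bases are closed under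
continuous preimages. -/
theorem statement14 {X Y Q : Type} [Preorder Q] [TopologicalSpace X] [TopologicalSpace Y]
    [SecondCountableTopology X] [T0Space X] [SecondCountableTopology Y] [T0Space Y]
    (f : X → Y) (hf : Continuous f) (u : Term Q) (A : Y → Q)
    (hA : A ∈ level Q (borelBase Y) u) :
    (A ∘ f) ∈ level Q (borelBase X) u := by
  exact comp_mem_levelOn (fun α => preimage_mem_SigmaO hf (1 + α)) hA

end

end IFHpaper
end

section
/- Let Q be a quasiorder, X a second-countable T₀ topological space, and u a term. Then red-𝓛¹(X,u) = 𝓛¹(X,u), where 𝓛¹(X) is the 1-shift of the Borel base of X. If X is moreover zero-dimensional (has a basis of clopen sets), then red-𝓛(X,u) = 𝓛(X,u) for the Borel base 𝓛(X) itself. -/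
open Set

namespace IFHpaper

noncomputable section

/-- A collection closed under countable unions and binary intersections has the σ-reduction
property if its members are countable unions of sets that belong to it with their complements. -/
lemma sigmaReduction_of_iUnion {X : Type} {𝒜 : Set (Set X)}
    (hU : ∀ f : ℕ → Set X, (∀ n, f n ∈ 𝒜) → (⋃ n, f n) ∈ 𝒜)
    (hI : ∀ A B : Set X, A ∈ 𝒜 → B ∈ 𝒜 → A ∩ B ∈ 𝒜)
    (hD : ∀ A ∈ 𝒜, ∃ P : ℕ → Set X, (∀ n, P n ∈ 𝒜 ∧ (P n)ᶜ ∈ 𝒜) ∧ A = ⋃ n, P n) :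
    SigmaReduction 𝒜 := by
  intro C hC
  choose P hP hCP using fun i => hD (C i) (hC i)
  let R : ℕ → Set X := fun k => P k.unpair.1 k.unpair.2
  have hR : ∀ k, disjointed R k ∈ 𝒜 := fun k =>
    disjointedRec (p := fun s => s ∈ 𝒜)
      (fun {t i} ht => by
        rw [sdiff_eq]
        exact hI _ _ ht (hP _ _).2) ((hP _ _).1)
  have hRsub : ∀ k, disjointed R k ⊆ R k := disjointed_subset R
  refine ⟨fun i => ⋃ n, disjointed R (Nat.pair i n), fun i => hU _ fun n => hR _,
    fun i => ?_, fun i j hij => ?_, ?_⟩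
  · rw [hCP i]
    refine iUnion_mono fun n => ?_
    simpa [R] using hRsub (Nat.pair i n)
  · rw [← disjoint_iff_inter_eq_empty, disjoint_iUnion_left]
    intro n
    rw [disjoint_iUnion_right]
    intro m
    exact disjoint_disjointed R fun h => hij (Nat.pair_eq_pair.1 h).1
  · have h1 : (⋃ i, ⋃ n, disjointed R (Nat.pair i n)) = ⋃ k, disjointed R k := by
      refine Subset.antisymm
        (iUnion_subset fun i => iUnion_subset fun n => subset_iUnion (disjointed R) _)
        (iUnion_subset fun k => ?_)
      conv_lhs => rw [← Nat.pair_unpair k]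
      exact subset_iUnion₂ (s := fun i n => disjointed R (Nat.pair i n)) k.unpair.1 k.unpair.2
    rw [h1, iUnion_disjointed]
    refine Subset.antisymm (iUnion_subset fun k => ?_) (iUnion_subset fun i => ?_)
    · refine subset_iUnion_of_subset k.unpair.1 ?_
      rw [hCP]
      exact subset_iUnion (P _) _
    · rw [hCP i]
      refine iUnion_subset fun n => subset_iUnion_of_subset (Nat.pair i n) ?_
      simp [R]

section Borel

variable {X : Type} [TopologicalSpace X]

lemma mem_sigmaO_one {A : Set X} : A ∈ SigmaO X 1 ↔ IsOpen A := by
  rw [SigmaO, if_pos rfl, mem_ofPred_eq]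

lemma mem_sigmaO_two {A : Set X} : A ∈ SigmaO X 2 ↔
    ∃ U V : ℕ → Set X, (∀ n, IsOpen (U n)) ∧ (∀ n, IsOpen (V n)) ∧ A = ⋃ n, U n \ V n := by
  rw [SigmaO, if_neg (by norm_num), if_pos rfl, mem_ofPred_eq]

lemma mem_sigmaO_of_two_lt {α : Ordinal.{0}} (hα : 2 < α) {A : Set X} : A ∈ SigmaO X α ↔
    ∃ S : ℕ → Set X, (∀ n, ∃ β < α, 1 ≤ β ∧ S n ∈ SigmaO X β) ∧ A = ⋃ n, (S n)ᶜ := by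
  rw [SigmaO, if_neg (ne_of_gt (lt_trans (by norm_num) hα)), if_neg hα.ne', mem_ofPred_eq]
  simp only [exists_prop]

lemma ordinal_cases {α : Ordinal.{0}} (hα : 1 ≤ α) : α = 1 ∨ α = 2 ∨ 2 < α := by
  rcases hα.eq_or_lt with h | h
  · exact .inl h.symm
  · have h2 : (2 : Ordinal.{0}) ≤ α := by
      rw [← one_add_one_eq_two]
      exact Order.add_one_le_of_lt h
    rcases h2.eq_or_lt with h' | h'
    · exact .inr (.inl h'.symm)
    · exact .inr (.inr h')

lemma diff_mem_sigmaO_two {U V : Set X} (hU : IsOpen U) (hV : IsOpen V) :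
    U \ V ∈ SigmaO X 2 :=
  mem_sigmaO_two.2 ⟨fun _ => U, fun _ => V, fun _ => hU, fun _ => hV, (iUnion_const _).symm⟩

lemma sigmaO_iUnion {α : Ordinal.{0}} (hα : 1 ≤ α) {f : ℕ → Set X}
    (hf : ∀ n, f n ∈ SigmaO X α) : (⋃ n, f n) ∈ SigmaO X α := by
  have reindex (g : ℕ → ℕ → Set X) : ⋃ n, ⋃ m, g n m = ⋃ k : ℕ, g k.unpair.1 k.unpair.2 := by
    ext x
    simp only [mem_iUnion]
    refine ⟨fun ⟨n, m, h⟩ => ⟨Nat.pair n m, by simpa using h⟩, fun ⟨k, h⟩ => ⟨_, _, h⟩⟩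
  rcases ordinal_cases hα with rfl | rfl | h
  · exact mem_sigmaO_one.2 (isOpen_iUnion fun n => mem_sigmaO_one.1 (hf n))
  · choose U V hU hV h using fun n => mem_sigmaO_two.1 (hf n)
    refine mem_sigmaO_two.2 ⟨fun k => U k.unpair.1 k.unpair.2, fun k => V k.unpair.1 k.unpair.2,
      fun k => hU _ _, fun k => hV _ _, ?_⟩
    rw [iUnion_congr h, reindex fun n m => U n m \ V n m]
  · choose S hS hE using fun n => (mem_sigmaO_of_two_lt h).1 (hf n)
    refine (mem_sigmaO_of_two_lt h).2 ⟨fun k => S k.unpair.1 k.unpair.2, fun k => hS _ _, ?_⟩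
    rw [iUnion_congr hE, reindex fun n m => (S n m)ᶜ]

lemma sigmaO_union {α : Ordinal.{0}} (hα : 1 ≤ α) {A B : Set X}
    (hA : A ∈ SigmaO X α) (hB : B ∈ SigmaO X α) : A ∪ B ∈ SigmaO X α := by
  have h : A ∪ B = ⋃ n : ℕ, if n = 0 then A else B := by
    ext x
    simp only [mem_union, mem_iUnion]
    refine ⟨?_, fun ⟨n, hn⟩ => ?_⟩
    · rintro (hx | hx)
      · exact ⟨0, by simpa using hx⟩
      · exact ⟨1, by simpa using hx⟩
    · split_ifs at hn
      · exact .inl hn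
      · exact .inr hn
  rw [h]
  refine sigmaO_iUnion hα fun n => ?_
  split_ifs <;> assumption

lemma sigmaO_mono {α β : Ordinal.{0}} (hβ : 1 ≤ β) (hβα : β ≤ α) {A : Set X}
    (hA : A ∈ SigmaO X β) : A ∈ SigmaO X α := by
  rcases hβα.eq_or_lt with rfl | hlt
  · exact hA
  rcases ordinal_cases (hβ.trans hβα) with rfl | rfl | hα
  · exact absurd hlt hβ.not_gt
  · rcases ordinal_cases hβ with rfl | rfl | hβ2
    · simpa using diff_mem_sigmaO_two (mem_sigmaO_one.1 hA) isOpen_empty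
    · exact hA
    · exact absurd hlt hβ2.not_gt
  · rw [mem_sigmaO_of_two_lt hα]
    rcases ordinal_cases hβ with rfl | rfl | hβ2
    · refine ⟨fun _ => Aᶜ, fun _ => ⟨2, hα, by norm_num, ?_⟩,
        by simp only [compl_compl, iUnion_const]⟩
      simpa [compl_eq_univ_sdiff] using diff_mem_sigmaO_two isOpen_univ (mem_sigmaO_one.1 hA)
    · obtain ⟨U, V, hU, hV, rfl⟩ := mem_sigmaO_two.1 hA
      refine ⟨fun n => (univ \ U n) ∪ (V n \ ∅), fun n => ⟨2, hα, by norm_num, ?_⟩, ?_⟩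
      · exact sigmaO_union (by norm_num) (diff_mem_sigmaO_two isOpen_univ (hU n))
          (diff_mem_sigmaO_two (hV n) isOpen_empty)
      · refine iUnion_congr fun n => ?_
        ext x
        simp
    · obtain ⟨S, hS, rfl⟩ := (mem_sigmaO_of_two_lt hβ2).1 hA
      refine ⟨S, fun n => ?_, rfl⟩
      obtain ⟨γ, hγ, h1, hSγ⟩ := hS n
      exact ⟨γ, hγ.trans hlt, h1, hSγ⟩

lemma sigmaO_inter {α : Ordinal.{0}} (hα : 1 ≤ α) {A B : Set X}
    (hA : A ∈ SigmaO X α) (hB : B ∈ SigmaO X α) : A ∩ B ∈ SigmaO X α := by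
  rcases ordinal_cases hα with rfl | rfl | h
  · exact mem_sigmaO_one.2 ((mem_sigmaO_one.1 hA).inter (mem_sigmaO_one.1 hB))
  · obtain ⟨U, V, hU, hV, rfl⟩ := mem_sigmaO_two.1 hA
    obtain ⟨U', V', hU', hV', rfl⟩ := mem_sigmaO_two.1 hB
    rw [iUnion_inter]
    refine sigmaO_iUnion hα fun n => ?_
    rw [inter_iUnion]
    refine sigmaO_iUnion hα fun m => ?_
    have : (U n \ V n) ∩ (U' m \ V' m) = (U n ∩ U' m) \ (V n ∪ V' m) := by
      ext x
      simp only [mem_inter_iff, mem_sdiff, mem_union]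
      tauto
    rw [this]
    exact diff_mem_sigmaO_two ((hU n).inter (hU' m)) ((hV n).union (hV' m))
  · obtain ⟨S, hS, rfl⟩ := (mem_sigmaO_of_two_lt h).1 hA
    obtain ⟨T, hT, rfl⟩ := (mem_sigmaO_of_two_lt h).1 hB
    rw [iUnion_inter]
    refine sigmaO_iUnion hα fun n => ?_
    rw [inter_iUnion]
    refine sigmaO_iUnion hα fun m => ?_
    obtain ⟨β, hβ, h1, hSβ⟩ := hS n
    obtain ⟨γ, hγ, h1', hTγ⟩ := hT m
    rw [← compl_union]
    exact (mem_sigmaO_of_two_lt h).2 ⟨fun _ => S n ∪ T m, fun _ => ⟨max β γ, max_lt hβ hγ,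
      h1.trans (le_max_left _ _), sigmaO_union (h1.trans (le_max_left _ _))
        (sigmaO_mono h1 (le_max_left _ _) hSβ) (sigmaO_mono h1' (le_max_right _ _) hTγ)⟩,
      (iUnion_const _).symm⟩

lemma sigmaReduction_sigmaO {α : Ordinal.{0}} (hα : 2 ≤ α) : SigmaReduction (SigmaO X α) := by
  have h1 : 1 ≤ α := le_trans (by norm_num) hα
  refine sigmaReduction_of_iUnion (fun f hf => sigmaO_iUnion h1 hf)
    (fun A B hA hB => sigmaO_inter h1 hA hB) fun A hA => ?_
  rcases hα.eq_or_lt with rfl | h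
  · obtain ⟨U, V, hU, hV, rfl⟩ := mem_sigmaO_two.1 hA
    refine ⟨fun n => U n \ V n, fun n => ⟨diff_mem_sigmaO_two (hU n) (hV n), ?_⟩, rfl⟩
    have : (U n \ V n)ᶜ = (univ \ U n) ∪ (V n \ ∅) := by
      ext x
      simp [imp_iff_not_or]
    rw [this]
    exact sigmaO_union h1 (diff_mem_sigmaO_two isOpen_univ (hU n))
      (diff_mem_sigmaO_two (hV n) isOpen_empty)
  · obtain ⟨S, hS, rfl⟩ := (mem_sigmaO_of_two_lt h).1 hA
    refine ⟨fun n => (S n)ᶜ, fun n => ?_, rfl⟩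
    obtain ⟨β, hβ, h1', hSβ⟩ := hS n
    rw [compl_compl]
    exact ⟨(mem_sigmaO_of_two_lt h).2 ⟨fun _ => S n, fun _ => ⟨β, hβ, h1', hSβ⟩,
      (iUnion_const _).symm⟩, sigmaO_mono h1' hβ.le hSβ⟩

lemma sigmaReduction_open [SecondCountableTopology X] (hX : ZeroDim X) :
    SigmaReduction (SigmaO X 1) := by
  refine sigmaReduction_of_iUnion (fun f hf => sigmaO_iUnion le_rfl hf)
    (fun A B hA hB => sigmaO_inter le_rfl hA hB) fun A hA => ?_
  rw [mem_sigmaO_one] at hA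
  choose V hVc hxV hVA using fun x : A => hX x A hA x.2
  obtain ⟨T, hT, hTV⟩ := TopologicalSpace.isOpen_iUnion_countable V fun x => (hVc x).isOpen
  have hA' : A = ⋃ i ∈ T, V i := by
    rw [hTV]
    exact Subset.antisymm (fun x hx => mem_iUnion.2 ⟨⟨x, hx⟩, hxV ⟨x, hx⟩⟩) (iUnion_subset hVA)
  rcases T.eq_empty_or_nonempty with rfl | hne
  · refine ⟨fun _ => ∅, fun _ => ⟨mem_sigmaO_one.2 isOpen_empty, ?_⟩, by simpa using hA'⟩
    exact mem_sigmaO_one.2 (by simp)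
  · obtain ⟨e, rfl⟩ := hT.exists_eq_range hne
    refine ⟨fun n => V (e n), fun n => ⟨mem_sigmaO_one.2 (hVc _).isOpen,
      mem_sigmaO_one.2 (hVc _).compl.isOpen⟩, ?_⟩
    simpa using hA'

end Borel

lemma restrictL_inter {X : Type} {L : Ordinal.{0} → Set (Set X)} {α : Ordinal.{0}}
    {D D' W : Set X} (hD : D' ⊆ D) (hW : W ∈ restrictL L D α) : W ∩ D' ∈ restrictL L D' α := by
  obtain ⟨S, hS, rfl⟩ := hW
  refine ⟨S, hS, ?_⟩
  rw [inter_right_comm, inter_eq_right.2 hD]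

lemma diff_iUnion_inter_subset {X : Type} {D D' : Set X} (hD : D' ⊆ D) (U : ℕ → Set X) :
    D' \ ⋃ i, U i ∩ D' ⊆ D \ ⋃ i, U i := by
  rintro x ⟨hx, hxU⟩
  refine ⟨hD hx, fun h => hxU ?_⟩
  rw [← iUnion_inter]
  exact ⟨h, hx⟩

/-- Levels of the fine hierarchy are preserved by shrinking the domain. -/
lemma levelOn_subset {X Q : Type} {u : Term Q} {L : Ordinal.{0} → Set (Set X)} {D D' : Set X}
    (hD : D' ⊆ D) {A : X → Q} (hA : A ∈ levelOn Q L D u) : A ∈ levelOn Q L D' u := by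
  obtain ⟨F, hF⟩ := hA
  induction F generalizing D' with
  | const q L D => exact ⟨.const q L D', fun x hx => hF x (hD hx)⟩
  | s a u L D F ih =>
    obtain ⟨G, hG⟩ := ih hD hF
    exact ⟨.s a u L D' G, hG⟩
  | Fc q us L D U hU fams ih =>
    choose G hG using fun i => ih i (inter_subset_left : U i ∩ D' ⊆ U i) (hF.2 i)
    exact ⟨.Fc q us L D' (fun i => U i ∩ D') (fun i => restrictL_inter hD (hU i)) G,
      fun x hx => hF.1 x (diff_iUnion_inter_subset hD U hx), hG⟩
  | Fo a us L D U hU F0 fams ih0 ih =>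
    choose G hG using fun i => ih i (inter_subset_left : U i ∩ D' ⊆ U i) (hF.2 i)
    obtain ⟨G0, hG0⟩ := ih0 (diff_iUnion_inter_subset hD U) hF.1
    exact ⟨.Fo a us L D' (fun i => U i ∩ D') (fun i => restrictL_inter hD (hU i)) G0 G, hG0, hG⟩

/-- Level-`0` families of sets on a domain can be reduced if the base has the σ-reduction
property at level `0`. -/
lemma exists_reduction_restrictL {X : Type} {L : Ordinal.{0} → Set (Set X)}
    (hL : SigmaReduction (L 0)) {D : Set X} {U : ℕ → Set X} (hU : ∀ i, U i ∈ restrictL L D 0) :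
    ∃ U' : ℕ → Set X, (∀ i, U' i ∈ restrictL L D 0) ∧ (∀ i, U' i ⊆ U i) ∧
      (∀ i j, i ≠ j → U' i ∩ U' j = ∅) ∧ (⋃ i, U' i) = ⋃ i, U i := by
  choose S hS hUS using hU
  obtain ⟨S', hS', hsub, hdisj, hun⟩ := hL S hS
  refine ⟨fun i => D ∩ S' i, fun i => ⟨S' i, hS' i, rfl⟩, fun i => ?_, fun i j hij => ?_, ?_⟩
  · rw [hUS i]
    exact inter_subset_inter_right D (hsub i)
  · rw [← inter_inter_distrib_left, hdisj i j hij, inter_empty]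
  · rw [← inter_iUnion, hun, inter_iUnion, iUnion_congr hUS]

/-- Over a base with the σ-reduction property at all levels, every level of the fine hierarchy
is determined by reduced families. -/
lemma exists_famReduced {X Q : Type} {L : Ordinal.{0} → Set (Set X)}
    (hL : ∀ α, SigmaReduction (L α)) {D : Set X} {u : Term Q} {A : X → Q}
    (hA : A ∈ levelOn Q L D u) :
    ∃ F : Fam u L D, FamReduced u L D F ∧ Determines u L D F A := by
  induction u generalizing L D with
  | const q =>
    obtain ⟨F, hF⟩ := hA
    cases F
    exact ⟨.const q L D, trivial, hF⟩
  | s a u ih =>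
    obtain ⟨F, hF⟩ := hA
    cases F with
    | s _ _ _ _ F =>
    obtain ⟨G, hG, hGA⟩ := ih (fun α => hL (Ordinal.omega0 ^ a.1 + α)) ⟨F, hF⟩
    exact ⟨.s a u L D G, hG, hGA⟩
  | Fc q us ih =>
    obtain ⟨F, hF⟩ := hA
    cases F with
    | Fc _ _ _ _ U hU fams =>
    obtain ⟨U', hU', hsub, hdisj, hun⟩ := exists_reduction_restrictL (hL 0) hU
    choose G hG hGA using fun i => ih i hL (levelOn_subset (hsub i) ⟨fams i, hF.2 i⟩)
    refine ⟨.Fc q us L D U' hU' G, ⟨hdisj, hG⟩, ?_, hGA⟩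
    rw [hun]
    exact hF.1
  | Fo a us ih =>
    obtain ⟨F, hF⟩ := hA
    cases F with
    | Fo _ _ _ _ U hU F0 fams =>
    obtain ⟨U', hU', hsub, hdisj, hun⟩ := exists_reduction_restrictL (hL 0) hU
    choose G hG hGA using fun i => ih (i + 1) hL (levelOn_subset (hsub i) ⟨fams i, hF.2 i⟩)
    have h0 : A ∈ levelOn Q (shiftL L (Ordinal.omega0 ^ a.1)) (D \ ⋃ i, U' i) (us 0) := by
      rw [hun]
      exact ⟨F0, hF.1⟩
    obtain ⟨G0, hG0, hGA0⟩ := ih 0 (fun α => hL (Ordinal.omega0 ^ a.1 + α)) h0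
    exact ⟨.Fo a us L D U' hU' G0 G, ⟨hdisj, hG0, hG⟩, hGA0, hGA⟩

lemma levelRed_eq_level {X Q : Type} {L : Ordinal.{0} → Set (Set X)}
    (hL : ∀ α, SigmaReduction (L α)) (u : Term Q) : levelRed Q L u = level Q L u :=
  Subset.antisymm (fun _ ⟨F, _, hF⟩ => ⟨F, hF⟩) fun _ hA => exists_famReduced hL hA

/-- Proposition "reduc": `red-𝓛¹(X,u) = 𝓛¹(X,u)` for the 1-shift of the Borel base of a
second-countable `T₀` space, and `red-𝓛(X,u) = 𝓛(X,u)` if `X` is zero-dimensional. -/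
theorem statement17 {X Q : Type} [Preorder Q] [TopologicalSpace X]
    [SecondCountableTopology X] [T0Space X] (u : Term Q) :
    levelRed Q (shiftL (borelBase X) 1) u = level Q (shiftL (borelBase X) 1) u ∧
    (ZeroDim X → levelRed Q (borelBase X) u = level Q (borelBase X) u) := by
  have two_le {α : Ordinal.{0}} (hα : 1 ≤ α) : 2 ≤ 1 + α := by
    rw [← one_add_one_eq_two]
    exact add_le_add_right hα 1
  refine ⟨levelRed_eq_level (fun α => sigmaReduction_sigmaO (two_le le_self_add)) u,
    fun hX => levelRed_eq_level (fun α => ?_) u⟩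
  rcases eq_or_ne α 0 with rfl | hα
  · simpa [borelBase] using sigmaReduction_open hX
  · exact sigmaReduction_sigmaO (two_le (Order.one_le_iff_pos.2 (pos_iff_ne_zero.2 hα)))

end

end IFHpaper
end
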